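/- Let (Ω₁, ℱ₁, P₁) and (Ω₂, ℱ₂, P₂) be probability spaces, and let ν be a probability measure on the product (Ω₁×Ω₂, ℱ₁⊗ℱ₂) with marginals ν₁ and ν₂. Then H_{P₁×P₂}(ν) = H_{ν₁×ν₂}(ν) + H_{P₁}(ν₁) + H_{P₂}(ν₂), where H_Q(P) = sup over finite measurable partitions Π of S_Π(P|Q), values in [0,∞]. -/

import Mathlib

open MeasureTheory

/-- A finite measurable partition of the space, given as a finset of sets. -/
def IsFinPart {Ω : Type*} [MeasurableSpace Ω] (P : Finset (Set Ω)) : Prop :=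
  (∀ E ∈ P, MeasurableSet E) ∧ ((P : Set (Set Ω)).PairwiseDisjoint id) ∧
    ⋃₀ (P : Set (Set Ω)) = Set.univ

/-- The relative-entropy sum `S_Π(P|Q)` with the conventions `0·log(0/q) = 0` and
`p·log(p/0) = +∞` for `p > 0`. -/
noncomputable def partSum {Ω : Type*} [MeasurableSpace Ω] (P Q : Measure Ω)
    (Pt : Finset (Set Ω)) : EReal :=
  ∑ E ∈ Pt, if P E = 0 then (0 : EReal) else if Q E = 0 then ⊤ else
    (((P E).toReal * Real.log ((P E).toReal / (Q E).toReal) : ℝ) : EReal)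

/-- The relative entropy `H_Q(P) = sup_Π S_Π(P|Q)` over finite measurable partitions. -/
noncomputable def relEnt {Ω : Type*} [MeasurableSpace Ω] (P Q : Measure Ω) : EReal :=
  ⨆ Pt ∈ {Pt : Finset (Set Ω) | IsFinPart Pt}, partSum P Q Pt

section AuxLemmas

open InformationTheory

/-- The nonnegative cell contribution to the divergence. -/
noncomputable def auxCell {Ω : Type*} [MeasurableSpace Ω] (P Q : Measure Ω) (E : Set Ω) : ℝ :=
  klFun (P.real E / Q.real E)

theorem auxCell_nonneg {Ω : Type*} [MeasurableSpace Ω] (P Q : Measure Ω) (E : Set Ω) :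
    0 ≤ auxCell P Q E := klFun_nonneg (by positivity)

theorem aux_real_sum {Ω : Type*} [MeasurableSpace Ω] (P : Measure Ω) [IsProbabilityMeasure P]
    (Pt : Finset (Set Ω)) (h : IsFinPart Pt) : ∑ E ∈ Pt, P.real E = 1 := by
  have := measureReal_biUnion_finset (μ := P) (s := Pt) (f := id) h.2.1 h.1
  simp only [id] at this
  rw [← this]
  have h2 : (⋃ E ∈ Pt, E) = Set.univ := by
    rw [← h.2.2, Set.sUnion_eq_biUnion]; rfl
  rw [h2]; simp

theorem aux_lintegral {Ω : Type*} [MeasurableSpace Ω] (Q : Measure Ω)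
    (Pt : Finset (Set Ω)) (h : IsFinPart Pt) (g : Ω → ENNReal) :
    ∫⁻ x, g x ∂Q = ∑ E ∈ Pt, ∫⁻ x in E, g x ∂Q := by
  have := lintegral_biUnion_finset (μ := Q) (s := Pt) (t := id) h.2.1 h.1 g
  simp only [id] at this
  rw [← this]
  have h2 : (⋃ E ∈ Pt, E) = Set.univ := by
    rw [← h.2.2, Set.sUnion_eq_biUnion]; rfl
  rw [h2]; simp

theorem aux_coe_sum {ι : Type*} (s : Finset ι) (f : ι → ℝ) :
    ((∑ i ∈ s, f i : ℝ) : EReal) = ∑ i ∈ s, (f i : EReal) := by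
  classical
  induction s using Finset.induction_on with
  | empty => simp
  | insert a s ha ih => rw [Finset.sum_insert ha, Finset.sum_insert ha, EReal.coe_add, ih]

theorem aux_partSum {Ω : Type*} [MeasurableSpace Ω] (P Q : Measure Ω)
    [IsProbabilityMeasure P] [IsProbabilityMeasure Q] (hPQ : P ≪ Q)
    (Pt : Finset (Set Ω)) (h : IsFinPart Pt) :
    partSum P Q Pt = ((∑ E ∈ Pt, Q E * ENNReal.ofReal (auxCell P Q E) : ENNReal) : EReal) := by
  have e1 : partSum P Q Pt = ((∑ E ∈ Pt, P.real E * Real.log (P.real E / Q.real E) : ℝ) : EReal) := by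
    rw [aux_coe_sum]
    unfold partSum
    refine Finset.sum_congr rfl fun E _ => ?_
    split_ifs with h1 h2
    · simp [measureReal_def, h1]
    · exact absurd (hPQ h2) h1
    · rfl
  have e2 : ∑ E ∈ Pt, P.real E * Real.log (P.real E / Q.real E)
      = ∑ E ∈ Pt, Q.real E * auxCell P Q E := by
    have : ∑ E ∈ Pt, Q.real E * auxCell P Q E
        = ∑ E ∈ Pt, (P.real E * Real.log (P.real E / Q.real E) + Q.real E - P.real E) := by
      refine Finset.sum_congr rfl fun E _ => ?_
      unfold auxCell
      rw [klFun_apply]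
      by_cases h2 : Q.real E = 0
      · have : P.real E = 0 := by
          rw [measureReal_eq_zero_iff] at h2 ⊢
          exact hPQ h2
        simp [h2, this]
      · field_simp
    rw [this, Finset.sum_sub_distrib, Finset.sum_add_distrib, aux_real_sum P Pt h,
      aux_real_sum Q Pt h]
    ring
  have e3 : ∑ E ∈ Pt, Q E * ENNReal.ofReal (auxCell P Q E)
      = ENNReal.ofReal (∑ E ∈ Pt, Q.real E * auxCell P Q E) := by
    rw [ENNReal.ofReal_sum_of_nonneg
      (fun E _ => mul_nonneg measureReal_nonneg (auxCell_nonneg P Q E))]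
    refine Finset.sum_congr rfl fun E _ => ?_
    rw [ENNReal.ofReal_mul measureReal_nonneg, ofReal_measureReal]
  rw [e1, e2, e3, EReal.coe_ennreal_ofReal, max_eq_left]
  exact Finset.sum_nonneg (fun E _ => mul_nonneg measureReal_nonneg (auxCell_nonneg P Q E))

theorem aux_jensen {Ω : Type*} [MeasurableSpace Ω] (P Q : Measure Ω)
    [IsProbabilityMeasure P] [IsProbabilityMeasure Q] (hPQ : P ≪ Q) (E : Set Ω) :
    Q E * ENNReal.ofReal (auxCell P Q E)
      ≤ ∫⁻ x in E, ENNReal.ofReal (klFun (P.rnDeriv Q x).toReal) ∂Q := by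
  by_cases hE : Q E = 0
  · simp [hE]
  have hE' : 0 < Q.real E := by
    rw [measureReal_def]; exact ENNReal.toReal_pos hE (measure_ne_top _ _)
  by_cases hi : IntegrableOn (fun x => klFun (P.rnDeriv Q x).toReal) E Q
  · have j := convexOn_klFun.map_set_average_le continuous_klFun.continuousOn isClosed_Ici hE
      (measure_ne_top _ _) (f := fun x => (P.rnDeriv Q x).toReal) (by simp)
      Measure.integrable_toReal_rnDeriv.integrableOn hi
    rw [setAverage_eq, setAverage_eq, Measure.setIntegral_toReal_rnDeriv hPQ] at j
    simp only [smul_eq_mul] at j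
    rw [← ofReal_integral_eq_lintegral_ofReal hi
      (Filter.Eventually.of_forall fun x => klFun_nonneg ENNReal.toReal_nonneg),
      ← ofReal_measureReal, ← ENNReal.ofReal_mul measureReal_nonneg]
    apply ENNReal.ofReal_le_ofReal
    unfold auxCell
    rw [div_eq_inv_mul]
    calc _ ≤ _ := mul_le_mul_of_nonneg_left j hE'.le
      _ = _ := by field_simp
  · have : ∫⁻ x in E, ENNReal.ofReal (klFun (P.rnDeriv Q x).toReal) ∂Q = ⊤ := by
      by_contra hne
      apply hi
      refine ⟨(measurable_klFun.comp
        (Measure.measurable_rnDeriv P Q).ennreal_toReal).aestronglyMeasurable, ?_⟩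
      rw [hasFiniteIntegral_iff_ofReal
        (Filter.Eventually.of_forall fun x => klFun_nonneg ENNReal.toReal_nonneg)]
      exact lt_top_iff_ne_top.2 hne
    rw [this]; exact le_top

/-- Cells of the level-set partition. -/
noncomputable def auxIdx {Ω : Type*} (f : Ω → ℝ) (n : ℕ) (x : Ω) : ℕ := min ⌊n * f x⌋₊ (n * n)

theorem aux_measurable_idx {Ω : Type*} [MeasurableSpace Ω] (f : Ω → ℝ) (hf : Measurable f) (n : ℕ) :
    Measurable (auxIdx f n) := by
  unfold auxIdx
  exact (Nat.measurable_floor.comp (hf.const_mul _)).min measurable_const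

theorem aux_close {Ω : Type*} [MeasurableSpace Ω] (P Q : Measure Ω)
    [IsProbabilityMeasure P] [IsProbabilityMeasure Q] (hPQ : P ≪ Q) (E : Set Ω)
    (hE : MeasurableSet E) (h0 : Q E ≠ 0) (a b : ℝ)
    (hab : ∀ y ∈ E, a ≤ (P.rnDeriv Q y).toReal ∧ (P.rnDeriv Q y).toReal ≤ b) :
    a ≤ P.real E / Q.real E ∧ P.real E / Q.real E ≤ b := by
  have hE' : 0 < Q.real E := by
    rw [measureReal_def]; exact ENNReal.toReal_pos h0 (measure_ne_top _ _)
  have hi : IntegrableOn (fun x => (P.rnDeriv Q x).toReal) E Q :=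
    Measure.integrable_toReal_rnDeriv.integrableOn
  rw [le_div_iff₀ hE', div_le_iff₀ hE', ← Measure.setIntegral_toReal_rnDeriv hPQ]
  constructor
  · have := setIntegral_mono_on (integrableOn_const (C := a)) hi hE (fun y hy => (hab y hy).1)
    simpa [mul_comm] using this
  · have := setIntegral_mono_on hi (integrableOn_const (C := b)) hE (fun y hy => (hab y hy).2)
    simpa [mul_comm] using this

theorem aux_lower {Ω : Type*} [MeasurableSpace Ω] (P Q : Measure Ω)
    [IsProbabilityMeasure P] [IsProbabilityMeasure Q] (hPQ : P ≪ Q) :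
    (klDiv P Q : EReal) ≤ relEnt P Q := by
  classical
  set f : Ω → ℝ := fun x => (P.rnDeriv Q x).toReal with hf
  have hfm : Measurable f := (Measure.measurable_rnDeriv P Q).ennreal_toReal
  have hf0 : ∀ x, 0 ≤ f x := fun x => ENNReal.toReal_nonneg
  let k : ℕ → Ω → ℕ := auxIdx f
  have hk : ∀ n, Measurable (k n) := aux_measurable_idx f hfm
  let F : ℕ → Ω → ENNReal := fun n x => ENNReal.ofReal (auxCell P Q (k n ⁻¹' {k n x}))
  have hF : ∀ n, Measurable (F n) := by
    intro n
    exact (measurable_from_nat (f := fun j => ENNReal.ofReal (auxCell P Q (k n ⁻¹' {j})))).comp (hk n)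
  -- integral of F n is bounded
  have hb : ∀ n, ((∫⁻ x, F n x ∂Q : ENNReal) : EReal) ≤ relEnt P Q := by
    intro n
    let Pt : Finset (Set Ω) := (Finset.range (n * n + 1)).image fun j => k n ⁻¹' {j}
    have hPt : IsFinPart Pt := by
      refine ⟨?_, ?_, ?_⟩
      · intro E hE
        obtain ⟨j, -, rfl⟩ := Finset.mem_image.1 hE
        exact hk n (measurableSet_singleton j)
      · intro A hA B hB hAB
        obtain ⟨i, -, rfl⟩ := Finset.mem_image.1 (Finset.mem_coe.1 hA)
        obtain ⟨j, -, rfl⟩ := Finset.mem_image.1 (Finset.mem_coe.1 hB)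
        have hij : i ≠ j := fun h => hAB (by rw [h])
        simp only [Function.onFun, id]
        exact Disjoint.preimage _ (Set.disjoint_singleton.2 hij)
      · refine Set.eq_univ_of_forall fun x => ?_
        refine Set.mem_sUnion.2 ⟨k n ⁻¹' {k n x}, ?_, rfl⟩
        refine Finset.mem_coe.2 (Finset.mem_image.2 ⟨k n x, ?_, rfl⟩)
        exact Finset.mem_range.2 (Nat.lt_succ_of_le (min_le_right _ _))
    have : ∫⁻ x, F n x ∂Q = ∑ E ∈ Pt, Q E * ENNReal.ofReal (auxCell P Q E) := by
      rw [aux_lintegral Q Pt hPt]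
      refine Finset.sum_congr rfl fun E hE => ?_
      have hEm := hPt.1 E hE
      obtain ⟨j, -, rfl⟩ := Finset.mem_image.1 hE
      rw [setLIntegral_congr_fun hEm (g := fun _ => ENNReal.ofReal (auxCell P Q (k n ⁻¹' {j})))]
      · rw [setLIntegral_const, mul_comm]
      · intro x hx
        have : k n x = j := hx
        simp only [F, this]
    rw [this, ← aux_partSum P Q hPQ Pt hPt]
    exact le_iSup₂_of_le (f := fun Pt (_ : Pt ∈ {Pt : Finset (Set Ω) | IsFinPart Pt}) =>
      partSum P Q Pt) Pt hPt le_rfl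
  -- a.e. cells are non-null
  have hnull : ∀ᵐ x ∂Q, ∀ n, Q (k n ⁻¹' {k n x}) ≠ 0 := by
    rw [ae_all_iff]
    intro n
    have : ∀ᵐ x ∂Q, ∀ j, Q (k n ⁻¹' {j}) = 0 → x ∉ k n ⁻¹' {j} := by
      rw [ae_all_iff]
      intro j
      by_cases h : Q (k n ⁻¹' {j}) = 0
      · filter_upwards [measure_eq_zero_iff_ae_notMem.1 h] with x hx _ using hx
      · exact Filter.Eventually.of_forall fun x h' => absurd h' h
    filter_upwards [this] with x hx h0
    exact hx _ h0 rfl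
  have hlim : ∀ᵐ x ∂Q, Filter.Tendsto (fun n => F n x) Filter.atTop
      (nhds (ENNReal.ofReal (klFun (f x)))) := by
    filter_upwards [hnull] with x hx
    refine (ENNReal.continuous_ofReal.tendsto _).comp ?_
    refine (continuous_klFun.tendsto _).comp ?_
    have hev : ∀ᶠ n : ℕ in Filter.atTop, f x - 1 / (n : ℝ)
          ≤ P.real (k n ⁻¹' {k n x}) / Q.real (k n ⁻¹' {k n x}) ∧
        P.real (k n ⁻¹' {k n x}) / Q.real (k n ⁻¹' {k n x}) ≤ f x + 1 / (n : ℝ) := by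
      obtain ⟨N, hN⟩ := exists_nat_gt (f x)
      filter_upwards [Filter.eventually_ge_atTop (max N 1)] with n hn
      have hn1 : 1 ≤ n := le_trans (le_max_right _ _) hn
      have hnN : N ≤ n := le_trans (le_max_left _ _) hn
      have hnpos : (0 : ℝ) < n := by exact_mod_cast hn1
      have hfn : f x < n := hN.trans_le (by exact_mod_cast hnN)
      refine aux_close P Q hPQ _ (hk n (measurableSet_singleton _)) (hx n) _ _ ?_
      intro y hy
      have hlt : ⌊n * f x⌋₊ < n * n := by
        rw [Nat.floor_lt (mul_nonneg hnpos.le (hf0 x))]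
        push_cast
        exact mul_lt_mul_of_pos_left hfn hnpos
      have hyk : min ⌊n * f y⌋₊ (n * n) = min ⌊n * f x⌋₊ (n * n) := hy
      have hfl : ⌊n * f y⌋₊ = ⌊n * f x⌋₊ := by omega
      have a1 := Nat.floor_le (mul_nonneg hnpos.le (hf0 x))
      have a2 := Nat.lt_floor_add_one (n * f x)
      have b1 := Nat.floor_le (mul_nonneg hnpos.le (hf0 y))
      have b2 := Nat.lt_floor_add_one (n * f y)
      rw [hfl] at b1 b2
      have c : (n : ℝ) * (1 / n) = 1 := by field_simp
      constructor
      · refine le_of_mul_le_mul_left ?_ hnpos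
        rw [mul_sub, c]; simp only [hf] at *; linarith
      · refine le_of_mul_le_mul_left ?_ hnpos
        rw [mul_add, c]; simp only [hf] at *; linarith
    have z := tendsto_one_div_atTop_nhds_zero_nat (𝕜 := ℝ)
    refine tendsto_of_tendsto_of_tendsto_of_le_of_le' ?_ ?_
      (hev.mono fun n h => h.1) (hev.mono fun n h => h.2)
    · simpa using tendsto_const_nhds.sub z
    · simpa using tendsto_const_nhds.add z
  have hnn : (0 : EReal) ≤ relEnt P Q := le_trans (EReal.coe_ennreal_nonneg _) (hb 0)
  rw [← EReal.coe_toENNReal hnn, EReal.coe_ennreal_le_coe_ennreal_iff,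
    klDiv_eq_lintegral_klFun_of_ac hPQ]
  calc ∫⁻ x, ENNReal.ofReal (klFun (f x)) ∂Q
      = ∫⁻ x, Filter.liminf (fun n => F n x) Filter.atTop ∂Q :=
        lintegral_congr_ae (hlim.mono fun x h => h.liminf_eq.symm)
    _ ≤ Filter.liminf (fun n => ∫⁻ x, F n x ∂Q) Filter.atTop := lintegral_liminf_le hF
    _ ≤ (relEnt P Q).toENNReal := by
        refine Filter.liminf_le_of_frequently_le' (Filter.Frequently.of_forall fun n => ?_)
        rw [← EReal.coe_ennreal_le_coe_ennreal_iff, EReal.coe_toENNReal hnn]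
        exact hb n

theorem aux_relEnt_eq {Ω : Type*} [MeasurableSpace Ω] (P Q : Measure Ω)
    [IsProbabilityMeasure P] [IsProbabilityMeasure Q] :
    relEnt P Q = (klDiv P Q : EReal) := by
  classical
  by_cases hPQ : P ≪ Q
  · refine le_antisymm ?_ (aux_lower P Q hPQ)
    refine iSup₂_le fun Pt hPt => ?_
    rw [aux_partSum P Q hPQ Pt hPt, EReal.coe_ennreal_le_coe_ennreal_iff,
      klDiv_eq_lintegral_klFun_of_ac hPQ, aux_lintegral Q Pt hPt]
    exact Finset.sum_le_sum fun E _ => aux_jensen P Q hPQ E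
  · rw [klDiv_of_not_ac hPQ, EReal.coe_ennreal_top, eq_top_iff]
    obtain ⟨E, hEm, hQ, hP⟩ : ∃ E, MeasurableSet E ∧ Q E = 0 ∧ P E ≠ 0 := by
      by_contra! hcon
      exact hPQ (Measure.AbsolutelyContinuous.mk fun s hs h0 => hcon s hs h0)
    have hne : E ≠ Eᶜ := by
      obtain ⟨x, hx⟩ := nonempty_of_measure_ne_zero hP
      intro h
      have hx' := hx
      rw [h] at hx'
      exact hx' hx
    have hPt : IsFinPart ({E, Eᶜ} : Finset (Set Ω)) := by
      refine ⟨?_, ?_, ?_⟩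
      · intro A hA
        simp only [Finset.mem_insert, Finset.mem_singleton] at hA
        rcases hA with rfl | rfl
        · exact hEm
        · exact hEm.compl
      · intro A hA B hB hAB
        simp only [Finset.coe_insert, Finset.coe_singleton, Set.mem_insert_iff,
          Set.mem_singleton_iff] at hA hB
        simp only [Function.onFun, id]
        rcases hA with rfl | rfl <;> rcases hB with rfl | rfl
        · exact absurd rfl hAB
        · exact disjoint_compl_right
        · exact disjoint_compl_left
        · exact absurd rfl hAB
      · simp
    refine le_iSup₂_of_le (f := fun Pt (_ : Pt ∈ {Pt : Finset (Set Ω) | IsFinPart Pt}) =>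
      partSum P Q Pt) _ hPt ?_
    unfold partSum
    rw [Finset.sum_pair hne, if_neg hP, if_pos hQ, EReal.top_add_of_ne_bot]
    split_ifs
    · simp
    · simp
    · exact EReal.coe_ne_bot _

theorem aux_klDiv_prod {Ω₁ Ω₂ : Type*} [MeasurableSpace Ω₁] [MeasurableSpace Ω₂]
    (P₁ : Measure Ω₁) (P₂ : Measure Ω₂) [IsProbabilityMeasure P₁] [IsProbabilityMeasure P₂]
    (ν : Measure (Ω₁ × Ω₂)) [IsProbabilityMeasure ν] :
    klDiv ν (P₁.prod P₂) = klDiv ν (ν.fst.prod ν.snd) + klDiv ν.fst P₁ + klDiv ν.snd P₂ := by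
  have key : ∀ (h1 : ν.fst ≪ P₁) (h2 : ν.snd ≪ P₂) (h0 : ν ≪ ν.fst.prod ν.snd),
      llr ν (P₁.prod P₂) =ᵐ[ν] fun z => llr ν (ν.fst.prod ν.snd) z + llr ν.fst P₁ z.1
        + llr ν.snd P₂ z.2 := by
    intro h1 h2 h0
    have hP : ν.fst.prod ν.snd ≪ P₁.prod P₂ := h1.prod h2
    have hν : ν ≪ P₁.prod P₂ := h0.trans hP
    have e1 := Measure.rnDeriv_mul_rnDeriv (κ := P₁.prod P₂) h0
    have e2 : (ν.fst.prod ν.snd).rnDeriv (P₁.prod P₂) =ᵐ[P₁.prod P₂]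
        fun z => ν.fst.rnDeriv P₁ z.1 * ν.snd.rnDeriv P₂ z.2 := by
      have : ν.fst.prod ν.snd = (P₁.prod P₂).withDensity
          (fun z => ν.fst.rnDeriv P₁ z.1 * ν.snd.rnDeriv P₂ z.2) := by
        rw [← prod_withDensity (Measure.measurable_rnDeriv _ _) (Measure.measurable_rnDeriv _ _),
          Measure.withDensity_rnDeriv_eq _ _ h1, Measure.withDensity_rnDeriv_eq _ _ h2]
      conv_lhs => rw [this]
      exact Measure.rnDeriv_withDensity _ (by fun_prop)
    have p1 : ∀ᵐ z ∂ν, 0 < ν.fst.rnDeriv P₁ z.1 :=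
      ae_of_ae_map measurable_fst.aemeasurable (Measure.rnDeriv_pos h1)
    have p2 : ∀ᵐ z ∂ν, 0 < ν.snd.rnDeriv P₂ z.2 :=
      ae_of_ae_map measurable_snd.aemeasurable (Measure.rnDeriv_pos h2)
    have t1 : ∀ᵐ z ∂ν, ν.fst.rnDeriv P₁ z.1 < ⊤ :=
      ae_of_ae_map measurable_fst.aemeasurable (h1.ae_le (Measure.rnDeriv_lt_top _ _))
    have t2 : ∀ᵐ z ∂ν, ν.snd.rnDeriv P₂ z.2 < ⊤ :=
      ae_of_ae_map measurable_snd.aemeasurable (h2.ae_le (Measure.rnDeriv_lt_top _ _))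
    have p0 := Measure.rnDeriv_pos h0
    have t0 := h0.ae_le (Measure.rnDeriv_lt_top ν (ν.fst.prod ν.snd))
    filter_upwards [hν.ae_le e1, hν.ae_le e2, p1, p2, t1, t2, p0, t0]
      with z e1 e2 p1 p2 t1 t2 p0 t0
    have q1 := ENNReal.toReal_pos p1.ne' t1.ne
    have q2 := ENNReal.toReal_pos p2.ne' t2.ne
    have q0 := ENNReal.toReal_pos p0.ne' t0.ne
    simp only [llr]
    rw [← e1, Pi.mul_apply, e2, ENNReal.toReal_mul, ENNReal.toReal_mul,
      Real.log_mul q0.ne' (mul_pos q1 q2).ne', Real.log_mul q1.ne' q2.ne', add_assoc]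
  have comp1 : ∀ {i : Integrable (llr ν.fst P₁) ν.fst},
      Integrable (fun z : Ω₁ × Ω₂ => llr ν.fst P₁ z.1) ν := fun {i} =>
    i.comp_measurable measurable_fst
  have comp2 : ∀ {i : Integrable (llr ν.snd P₂) ν.snd},
      Integrable (fun z : Ω₁ × Ω₂ => llr ν.snd P₂ z.2) ν := fun {i} =>
    i.comp_measurable measurable_snd
  by_cases hL : klDiv ν (P₁.prod P₂) = ⊤
  · by_contra hne
    have hR : klDiv ν (ν.fst.prod ν.snd) + klDiv ν.fst P₁ + klDiv ν.snd P₂ ≠ ⊤ := by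
      rw [hL] at hne; exact fun h => hne h.symm
    simp only [ENNReal.add_ne_top] at hR
    obtain ⟨⟨k0, k1⟩, k2⟩ := hR
    obtain ⟨h0, i0⟩ := klDiv_ne_top_iff.1 k0
    obtain ⟨h1, i1⟩ := klDiv_ne_top_iff.1 k1
    obtain ⟨h2, i2⟩ := klDiv_ne_top_iff.1 k2
    refine klDiv_ne_top (h0.trans (h1.prod h2)) ?_ hL
    rw [integrable_congr (key h1 h2 h0)]
    exact (i0.add (comp1 (i := i1))).add (comp2 (i := i2))
  · have k1 : klDiv ν.fst P₁ ≠ ⊤ := by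
      have := klDiv_map_le ν (P₁.prod P₂) measurable_fst
      rw [← Measure.fst, ← Measure.fst, Measure.fst_prod] at this
      exact ne_top_of_le_ne_top hL this
    have k2 : klDiv ν.snd P₂ ≠ ⊤ := by
      have := klDiv_map_le ν (P₁.prod P₂) measurable_snd
      rw [← Measure.snd, ← Measure.snd, Measure.snd_prod] at this
      exact ne_top_of_le_ne_top hL this
    obtain ⟨h, i⟩ := klDiv_ne_top_iff.1 hL
    obtain ⟨h1, i1⟩ := klDiv_ne_top_iff.1 k1
    obtain ⟨h2, i2⟩ := klDiv_ne_top_iff.1 k2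
    have h0 : ν ≪ ν.fst.prod ν.snd := by
      have e : ν.fst.prod ν.snd = (P₁.prod P₂).withDensity
          (fun z => ν.fst.rnDeriv P₁ z.1 * ν.snd.rnDeriv P₂ z.2) := by
        rw [← prod_withDensity (Measure.measurable_rnDeriv _ _) (Measure.measurable_rnDeriv _ _),
          Measure.withDensity_rnDeriv_eq _ _ h1, Measure.withDensity_rnDeriv_eq _ _ h2]
      have p1 : ∀ᵐ z ∂ν, 0 < ν.fst.rnDeriv P₁ z.1 :=
        ae_of_ae_map measurable_fst.aemeasurable (Measure.rnDeriv_pos h1)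
      have p2 : ∀ᵐ z ∂ν, 0 < ν.snd.rnDeriv P₂ z.2 :=
        ae_of_ae_map measurable_snd.aemeasurable (Measure.rnDeriv_pos h2)
      intro A hA
      rw [e, withDensity_apply_eq_zero (by fun_prop)] at hA
      have hA' := measure_eq_zero_iff_ae_notMem.1 (h hA)
      rw [measure_eq_zero_iff_ae_notMem]
      filter_upwards [hA', p1, p2] with z hz p1 p2 hzA
      exact hz ⟨mul_ne_zero p1.ne' p2.ne', hzA⟩
    have i0 : Integrable (llr ν (ν.fst.prod ν.snd)) ν := by
      have := (i.sub (comp1 (i := i1))).sub (comp2 (i := i2))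
      refine this.congr ?_
      filter_upwards [key h1 h2 h0] with z hz
      simp only [Pi.sub_apply, hz]; ring
    have k0 := klDiv_ne_top h0 i0
    rw [← ENNReal.toReal_eq_toReal_iff' hL (by simp [k0, k1, k2]),
      ENNReal.toReal_add (by simp [k0, k1]) k2, ENNReal.toReal_add k0 k1,
      toReal_klDiv_of_measure_eq h (by simp), toReal_klDiv_of_measure_eq h0 (by simp),
      toReal_klDiv_of_measure_eq h1 (by simp), toReal_klDiv_of_measure_eq h2 (by simp),
      integral_congr_ae (key h1 h2 h0)]
    have c1 : Integrable (fun z : Ω₁ × Ω₂ => llr ν.fst P₁ z.1) ν := comp1 (i := i1)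
    have c2 : Integrable (fun z : Ω₁ × Ω₂ => llr ν.snd P₂ z.2) ν := comp2 (i := i2)
    have c01 : Integrable (fun z => llr ν (ν.fst.prod ν.snd) z + llr ν.fst P₁ z.1) ν := i0.add c1
    rw [integral_add c01 c2, integral_add i0 c1]
    congr 1
    · congr 1
      exact (integral_map measurable_fst.aemeasurable i1.aestronglyMeasurable).symm
    · exact (integral_map measurable_snd.aemeasurable i2.aestronglyMeasurable).symm

end AuxLemmas

/-- `H_{P₁×P₂}(ν) = H_{ν₁×ν₂}(ν) + H_{P₁}(ν₁) + H_{P₂}(ν₂)`. -/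
theorem relEnt_prod_eq {Ω₁ Ω₂ : Type*} [MeasurableSpace Ω₁] [MeasurableSpace Ω₂]
    (P₁ : Measure Ω₁) (P₂ : Measure Ω₂) [IsProbabilityMeasure P₁] [IsProbabilityMeasure P₂]
    (ν : Measure (Ω₁ × Ω₂)) [IsProbabilityMeasure ν] :
    relEnt ν (P₁.prod P₂) = relEnt ν (ν.fst.prod ν.snd) + relEnt ν.fst P₁ + relEnt ν.snd P₂ := by
  rw [aux_relEnt_eq, aux_relEnt_eq, aux_relEnt_eq, aux_relEnt_eq, aux_klDiv_prod,
    EReal.coe_ennreal_add, EReal.coe_ennreal_add]
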